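/- Let a > 0 be real and let b, c ∈ ℂ. Define F : ℂ ∖ {b} → ℂ by F(z) = (1/(a(z − b))) (1 − e^{−a(z − b)(z̄ − c)}), where z̄ denotes the complex conjugate of z. Then F is differentiable as a map ℝ² → ℂ on ℂ ∖ {b}, and for every z ≠ b one has ∂̄F(z) = e^{−a(z − b)(z̄ − c)}; that is, F is an explicit anti-derivative of the Gaussian-type function e^{−a(z − b)(z̄ − c)} with respect to the ∂̄ operator away from z = b. -/

import Mathlib

open Complex Filter

/-- The Wirtinger derivative ∂̄f = ½(∂ₓf + i ∂_y f) of a function f : ℂ → ℂ,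
viewed as a map ℝ² → ℂ. -/
noncomputable def dbar (f : ℂ → ℂ) (z : ℂ) : ℂ :=
  (1 / 2) * (fderiv ℝ f z 1 + Complex.I * fderiv ℝ f z Complex.I)

/-- For a > 0 and b, c ∈ ℂ, the function F(z) = (1/(a(z − b)))(1 − e^{−a(z−b)(z̄−c)}) is
(real-)differentiable away from z = b and satisfies ∂̄F(z) = e^{−a(z−b)(z̄−c)} there;
i.e. F is an explicit ∂̄-antiderivative of the Gaussian-type function. -/
theorem stmt11 (a : ℝ) (ha : 0 < a) (b c : ℂ) :
    (∀ z : ℂ, z ≠ b → DifferentiableAt ℝ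
      (fun w : ℂ => (1 / ((a : ℂ) * (w - b))) *
        (1 - Complex.exp (-(a : ℂ) * (w - b) * ((starRingEnd ℂ) w - c)))) z) ∧
    (∀ z : ℂ, z ≠ b →
      dbar (fun w : ℂ => (1 / ((a : ℂ) * (w - b))) *
          (1 - Complex.exp (-(a : ℂ) * (w - b) * ((starRingEnd ℂ) w - c)))) z =
        Complex.exp (-(a : ℂ) * (z - b) * ((starRingEnd ℂ) z - c))) := by
  have key : ∀ z : ℂ, z ≠ b → ∃ L : ℂ →L[ℝ] ℂ, HasFDerivAt
      (fun w : ℂ => (1 / ((a : ℂ) * (w - b))) *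
        (1 - Complex.exp (-(a : ℂ) * (w - b) * ((starRingEnd ℂ) w - c)))) L z ∧
      (1 / 2) * (L 1 + Complex.I * L Complex.I) =
        Complex.exp (-(a : ℂ) * (z - b) * ((starRingEnd ℂ) z - c)) := by
    intro z hz
    have ha' : (a : ℂ) ≠ 0 := by exact_mod_cast ha.ne'
    have hzb : z - b ≠ 0 := sub_ne_zero.mpr hz
    have h1 : HasFDerivAt (fun w : ℂ => (starRingEnd ℂ) w - c)
        (Complex.conjCLE : ℂ →L[ℝ] ℂ) z :=
      (Complex.conjCLE.hasFDerivAt (x := z)).sub_const c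
    have h2 : HasDerivAt (fun w : ℂ => -(a : ℂ) * (w - b)) (-(a : ℂ)) z := by
      simpa using ((hasDerivAt_id z).sub_const b).const_mul (-(a : ℂ))
    have h3 : HasDerivAt (fun w : ℂ => 1 / ((a : ℂ) * (w - b)))
        (-(a : ℂ) / ((a : ℂ) * (z - b)) ^ 2) z := by
      have h := (((hasDerivAt_id z).sub_const b).const_mul (a : ℂ)).inv (mul_ne_zero ha' hzb)
      simp only [one_div]
      exact h.congr_deriv (by simp)
    have h2' := h2.hasFDerivAt.restrictScalars ℝ
    have h3' := h3.hasFDerivAt.restrictScalars ℝ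
    have h4 := (h2'.mul h1).cexp
    have h5 := h3'.mul (h4.const_sub 1)
    refine ⟨_, h5, ?_⟩
    simp
    generalize Complex.exp _ = E
    generalize (starRingEnd ℂ) z = y
    field_simp
    ring_nf
    simp only [Complex.I_sq]
    ring
  refine ⟨fun z hz => ?_, fun z hz => ?_⟩
  · obtain ⟨L, hL, -⟩ := key z hz
    exact hL.differentiableAt
  · obtain ⟨L, hL, h⟩ := key z hz
    rw [dbar, hL.fderiv]
    exact h
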